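/- arXiv:2512.01482 — 2 statements merged into one kernel-verified Lean document; each statement's English description precedes it below -/
import Mathlib

section
/- Let Φ ∈ ℝ^10 and let ζ ≥ 0. If ζ·I₄ − f(Φ) is positive definite, then 2ζ·I₆ − Z(Φ) is positive definite. -/
noncomputable section

open Matrix

/-- The skew-symmetric cross-product matrix `𝒮(x)` with `𝒮(x) y = x × y`. -/
def crossMat (x : Fin 3 → ℝ) : Matrix (Fin 3) (Fin 3) ℝ :=
  !![0, -x 2, x 1; x 2, 0, -x 0; -x 1, x 0, 0]

/-- The first moment of mass `h = (h₁,h₂,h₃)` from `Φ`. -/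
def hVec (Φ : Fin 10 → ℝ) : Fin 3 → ℝ := ![Φ 1, Φ 2, Φ 3]

/-- The inertia matrix `I` from `Φ = (m,h₁,h₂,h₃,I₁₁,I₂₂,I₃₃,I₁₂,I₂₃,I₁₃)`. -/
def Imat (Φ : Fin 10 → ℝ) : Matrix (Fin 3) (Fin 3) ℝ :=
  !![Φ 4, Φ 7, Φ 9; Φ 7, Φ 5, Φ 8; Φ 9, Φ 8, Φ 6]

/-- `Σ = (1/2)·tr(I)·I₃ − I`. -/
def SigmaMat (Φ : Fin 10 → ℝ) : Matrix (Fin 3) (Fin 3) ℝ :=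
  ((1 / 2 : ℝ) * (Imat Φ).trace) • (1 : Matrix (Fin 3) (Fin 3) ℝ) - Imat Φ

/-- The 4×4 matrix `f(Φ) = [[Σ, h],[hᵀ, m]]`. -/
def fMat (Φ : Fin 10 → ℝ) : Matrix (Fin 3 ⊕ Fin 1) (Fin 3 ⊕ Fin 1) ℝ :=
  Matrix.fromBlocks (SigmaMat Φ) (Matrix.of fun i _ => hVec Φ i)
    (Matrix.of fun _ j => hVec Φ j) (Matrix.of fun _ _ => Φ 0)

/-- The 6×6 matrix `Z(Φ) = [[m·I₃, −𝒮(h)],[−𝒮(h)ᵀ, I]]`. -/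
def ZMat (Φ : Fin 10 → ℝ) : Matrix (Fin 3 ⊕ Fin 3) (Fin 3 ⊕ Fin 3) ℝ :=
  Matrix.fromBlocks (Φ 0 • (1 : Matrix (Fin 3) (Fin 3) ℝ)) (-(crossMat (hVec Φ)))
    (-(crossMat (hVec Φ))ᵀ) (Imat Φ)

/-- The `i`-th row of the `3 × 4` matrix `[𝒮(w), v]`. -/
def crossRow (x : Fin 3 ⊕ Fin 3 → ℝ) (i : Fin 3) : Fin 3 ⊕ Fin 1 → ℝ :=
  Sum.elim (crossMat (x ∘ Sum.inr) i) fun _ => x (Sum.inl i)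

lemma eq_zero_of_crossRow_eq_zero {x : Fin 3 ⊕ Fin 3 → ℝ} (hx : ∀ i, crossRow x i = 0) :
    x = 0 := by
  have h01 := congrFun (hx 0) (Sum.inl 1)
  have h02 := congrFun (hx 0) (Sum.inl 2)
  have h12 := congrFun (hx 1) (Sum.inl 2)
  ext (i | i)
  · simpa [crossRow] using congrFun (hx i) (Sum.inr 0)
  · fin_cases i <;> simp_all [crossRow, crossMat]

lemma isHermitian_ZMat (Φ : Fin 10 → ℝ) : (ZMat Φ).IsHermitian := by
  refine Matrix.IsHermitian.fromBlocks ?_ ?_ ?_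
  · simp [Matrix.IsHermitian]
  · simp [Matrix.conjTranspose_eq_transpose_of_trivial]
  · ext i j
    fin_cases i <;> fin_cases j <;> simp [Imat]

/-- The quadratic form of `2ζ·I₆ − Z(Φ)` at `(v, w)` is the sum of the values of the quadratic form
of `ζ·I₄ − f(Φ)` at the rows of `[𝒮(w), v]`, plus `ζ‖v‖²`. -/
lemma dotProduct_smul_one_sub_ZMat_mulVec (Φ : Fin 10 → ℝ) (ζ : ℝ) (x : Fin 3 ⊕ Fin 3 → ℝ) :
    x ⬝ᵥ (((2 * ζ) • (1 : Matrix (Fin 3 ⊕ Fin 3) (Fin 3 ⊕ Fin 3) ℝ) - ZMat Φ) *ᵥ x) =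
      ∑ i, crossRow x i ⬝ᵥ
        ((ζ • (1 : Matrix (Fin 3 ⊕ Fin 1) (Fin 3 ⊕ Fin 1) ℝ) - fMat Φ) *ᵥ crossRow x i) +
      ζ * ∑ i, x (Sum.inl i) ^ 2 := by
  simp only [sub_mulVec, smul_mulVec, one_mulVec]
  simp [dotProduct, mulVec, Fin.sum_univ_three, ZMat, fMat, SigmaMat, Imat, hVec, crossMat,
    crossRow, trace, Matrix.one_apply]
  ring

/-- If `ζ·I₄ − f(Φ) ≻ 0` with `ζ ≥ 0`, then `2ζ·I₆ − Z(Φ) ≻ 0`. -/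
theorem smul_one_sub_ZMat_posDef_of_fMat (Φ : Fin 10 → ℝ) (ζ : ℝ) (hζ : 0 ≤ ζ)
    (hf : (ζ • (1 : Matrix (Fin 3 ⊕ Fin 1) (Fin 3 ⊕ Fin 1) ℝ) - fMat Φ).PosDef) :
    ((2 * ζ) • (1 : Matrix (Fin 3 ⊕ Fin 3) (Fin 3 ⊕ Fin 3) ℝ) - ZMat Φ).PosDef := by
  refine .of_dotProduct_mulVec_pos ?_ fun x hx => ?_
  · exact (Matrix.isHermitian_one.smul (IsSelfAdjoint.all _)).sub (isHermitian_ZMat Φ)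
  · obtain ⟨i, hi⟩ : ∃ i, crossRow x i ≠ 0 := by
      by_contra! h
      exact hx (eq_zero_of_crossRow_eq_zero h)
    rw [star_trivial, dotProduct_smul_one_sub_ZMat_mulVec]
    refine add_pos_of_pos_of_nonneg (Finset.sum_pos' (fun j _ => ?_) ⟨i, Finset.mem_univ i, ?_⟩)
      (by positivity)
    · simpa using hf.posSemidef.dotProduct_mulVec_nonneg (crossRow x j)
    · simpa using hf.dotProduct_mulVec_pos hi

end
end

section
/- (Finite positive uniform bounds of the mass matrix.) Let n, N ≥ 1, let J : ℝⁿ → ℝ^{(6N)×n}, and let Θ : [0,∞) → ℝ^{10N} with components Φ_l(t) ∈ ℝ^10. Suppose: there is γ > 0 such that J(q)ᵀJ(q) − γ·I_n is positive semidefinite for all q ∈ ℝⁿ; there is δ ≥ 0 such that δ·I_n − J(q)ᵀJ(q) is positive semidefinite for all q ∈ ℝⁿ; there is ξ > 0 such that f(Φ_l(t)) − ξ·I₄ is positive definite for all t ≥ 0 and l ∈ {1,…,N}; and there is ζ ≥ 0 such that ζ·I₄ − f(Φ_l(t)) is positive definite for all t ≥ 0 and l ∈ {1,…,N}. Then there exist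 constants 0 < α₁ ≤ α₂ < ∞ such that for all q ∈ ℝⁿ and all t ≥ 0 both M(q,Θ(t)) − α₁·I_n and α₂·I_n − M(q,Θ(t)) are positive semidefinite. -/
noncomputable section

open Matrix

/-- `𝒵(Θ) = blockdiag(Z(Φ₁),…,Z(Φ_N))`. -/
def calZ {N : ℕ} (Θ : Fin N → Fin 10 → ℝ) :
    Matrix ((Fin 3 ⊕ Fin 3) × Fin N) ((Fin 3 ⊕ Fin 3) × Fin N) ℝ :=
  Matrix.blockDiagonal fun l => ZMat (Θ l)

/-- The mass matrix `M(q,Θ) = J(q)ᵀ 𝒵(Θ) J(q)`. -/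
def massMatrix {n N : ℕ}
    (J : (Fin n → ℝ) → Matrix ((Fin 3 ⊕ Fin 3) × Fin N) (Fin n) ℝ)
    (Θ : Fin N → Fin 10 → ℝ) (q : Fin n → ℝ) : Matrix (Fin n) (Fin n) ℝ :=
  (J q)ᵀ * calZ Θ * J q

/-- The matrix taking the rigid-body twist `(v, w)` to the coefficients `(e_k × w, v_k)` of the
affine function `r ↦ v_k + (w × r)_k`, the `k`-th component of the velocity field. -/
def velocityCoeff (k : Fin 3) : Matrix (Fin 3 ⊕ Fin 1) (Fin 3 ⊕ Fin 3) ℝ :=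
  Matrix.fromBlocks 0 (crossMat (Pi.single k 1)) (Matrix.of fun _ => Pi.single k 1) 0

lemma sum_velocityCoeff_fMat (Φ : Fin 10 → ℝ) :
    ∑ k, (velocityCoeff k)ᵀ * fMat Φ * velocityCoeff k = ZMat Φ := by
  simp only [velocityCoeff, fMat, ZMat, SigmaMat, hVec, Matrix.fromBlocks_transpose,
    Matrix.fromBlocks_multiply, Fin.sum_univ_three, Matrix.fromBlocks_add, Matrix.fromBlocks_inj]
  refine ⟨?_, ?_, ?_, ?_⟩ <;> ext i j <;> fin_cases i <;> fin_cases j <;>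
    simp [Imat, crossMat, Fin.sum_univ_three, Matrix.mul_apply, Matrix.trace] <;> ring

lemma sum_velocityCoeff_transpose_mul_self :
    ∑ k, (velocityCoeff k)ᵀ * velocityCoeff k =
      Matrix.diagonal (Sum.elim (fun _ => 1) (fun _ => 2)) := by
  simp only [velocityCoeff, ← Matrix.fromBlocks_diagonal, Matrix.fromBlocks_transpose,
    Matrix.fromBlocks_multiply, Fin.sum_univ_three, Matrix.fromBlocks_add, Matrix.fromBlocks_inj]
  refine ⟨?_, ?_, ?_, ?_⟩ <;> ext i j <;> fin_cases i <;> fin_cases j <;>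
    simp [crossMat, Fin.sum_univ_three, Matrix.mul_apply] <;> norm_num

lemma Matrix.PosSemidef.transpose_mul_mul_same {m n : Type*} [Fintype m] [Fintype n]
    {A : Matrix m m ℝ} (hA : A.PosSemidef) (B : Matrix m n ℝ) : (Bᵀ * A * B).PosSemidef := by
  simpa using hA.conjTranspose_mul_mul_same B

lemma ZMat_sub_smul_one_posSemidef {Φ : Fin 10 → ℝ} {ξ : ℝ} (hξ : 0 ≤ ξ)
    (h : (fMat Φ - ξ • (1 : Matrix (Fin 3 ⊕ Fin 1) (Fin 3 ⊕ Fin 1) ℝ)).PosSemidef) :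
    (ZMat Φ - ξ • (1 : Matrix (Fin 3 ⊕ Fin 3) (Fin 3 ⊕ Fin 3) ℝ)).PosSemidef := by
  have key : ZMat Φ - ξ • (1 : Matrix (Fin 3 ⊕ Fin 3) (Fin 3 ⊕ Fin 3) ℝ) =
      ∑ k, (velocityCoeff k)ᵀ * (fMat Φ - ξ • 1) * velocityCoeff k +
        Matrix.diagonal (Sum.elim (fun _ => 0) (fun _ => ξ)) := by
    simp only [Matrix.mul_sub, Matrix.sub_mul, Finset.sum_sub_distrib, sum_velocityCoeff_fMat,
      Matrix.mul_smul, Matrix.smul_mul, Matrix.mul_one, ← Finset.smul_sum,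
      sum_velocityCoeff_transpose_mul_self]
    simp only [sub_add, ← Matrix.diagonal_one, ← Matrix.diagonal_smul, Matrix.diagonal_sub]
    congr 2
    funext i
    rcases i with i | i <;> simp <;> ring
  rw [key]
  refine (Matrix.posSemidef_sum _ fun k _ => h.transpose_mul_mul_same _).add (.diagonal ?_)
  rintro (i | i) <;> simp [hξ]

lemma smul_one_sub_ZMat_posSemidef {Φ : Fin 10 → ℝ} {ζ : ℝ} (hζ : 0 ≤ ζ)
    (h : (ζ • (1 : Matrix (Fin 3 ⊕ Fin 1) (Fin 3 ⊕ Fin 1) ℝ) - fMat Φ).PosSemidef) :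
    ((2 * ζ) • (1 : Matrix (Fin 3 ⊕ Fin 3) (Fin 3 ⊕ Fin 3) ℝ) - ZMat Φ).PosSemidef := by
  have key : (2 * ζ) • (1 : Matrix (Fin 3 ⊕ Fin 3) (Fin 3 ⊕ Fin 3) ℝ) - ZMat Φ =
      ∑ k, (velocityCoeff k)ᵀ * (ζ • 1 - fMat Φ) * velocityCoeff k +
        Matrix.diagonal (Sum.elim (fun _ => ζ) (fun _ => 0)) := by
    simp only [Matrix.mul_sub, Matrix.sub_mul, Finset.sum_sub_distrib, sum_velocityCoeff_fMat,
      Matrix.mul_smul, Matrix.smul_mul, Matrix.mul_one, ← Finset.smul_sum,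
      sum_velocityCoeff_transpose_mul_self]
    simp only [sub_add_eq_add_sub, ← Matrix.diagonal_one, ← Matrix.diagonal_smul, Matrix.diagonal_add]
    congr 2
    funext i
    rcases i with i | i <;> simp <;> ring
  rw [key]
  refine (Matrix.posSemidef_sum _ fun k _ => h.transpose_mul_mul_same _).add (.diagonal ?_)
  rintro (i | i) <;> simp [hζ]

lemma Matrix.PosSemidef.blockDiagonal {m o : Type*} [Fintype m] [Fintype o] [DecidableEq o]
    {A : o → Matrix m m ℝ} (hA : ∀ l, (A l).PosSemidef) :
    (Matrix.blockDiagonal A).PosSemidef := by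
  refine .of_dotProduct_mulVec_nonneg
    (Matrix.isHermitian_blockDiagonal_iff.2 fun l => (hA l).isHermitian) fun x => ?_
  have key : star x ⬝ᵥ Matrix.blockDiagonal A *ᵥ x =
      ∑ l, star (fun i => x (i, l)) ⬝ᵥ A l *ᵥ fun i => x (i, l) := by
    simp only [dotProduct, Matrix.mulVec, Fintype.sum_prod_type_right, Matrix.blockDiagonal_apply,
      Pi.star_apply, ite_mul, zero_mul, Finset.sum_ite_irrel, Finset.sum_const_zero,
      Finset.sum_ite_eq, Finset.mem_univ, if_true]
  rw [key]
  exact Finset.sum_nonneg fun l _ => (hA l).dotProduct_mulVec_nonneg _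

lemma calZ_sub_smul_one {N : ℕ} (Θ : Fin N → Fin 10 → ℝ) (c : ℝ) :
    calZ Θ - c • 1 = Matrix.blockDiagonal fun l => ZMat (Θ l) - c • 1 := by
  rw [calZ, ← Matrix.blockDiagonal_one, ← Matrix.blockDiagonal_smul, ← Matrix.blockDiagonal_sub]
  rfl

lemma smul_one_sub_calZ {N : ℕ} (Θ : Fin N → Fin 10 → ℝ) (c : ℝ) :
    c • 1 - calZ Θ = Matrix.blockDiagonal fun l => c • 1 - ZMat (Θ l) := by
  rw [calZ, ← Matrix.blockDiagonal_one, ← Matrix.blockDiagonal_smul, ← Matrix.blockDiagonal_sub]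
  rfl

/-- Finite positive uniform bounds of the mass matrix: if the Jacobian is normal and
uniformly upper bounded and the inertial parameters are uniformly physically consistent
and upper bounded, then `α₁·I_n ⪯ M(q,Θ(t)) ⪯ α₂·I_n` for some `0 < α₁ ≤ α₂ < ∞`. -/
theorem massMatrix_uniform_bounds {n N : ℕ} (hn : 1 ≤ n) (hN : 1 ≤ N)
    (J : (Fin n → ℝ) → Matrix ((Fin 3 ⊕ Fin 3) × Fin N) (Fin n) ℝ)
    (Θ : ℝ → Fin N → Fin 10 → ℝ)
    (γ : ℝ) (hγ : 0 < γ)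
    (hJl : ∀ q, ((J q)ᵀ * J q - γ • (1 : Matrix (Fin n) (Fin n) ℝ)).PosSemidef)
    (δ : ℝ) (hδ : 0 ≤ δ)
    (hJu : ∀ q, (δ • (1 : Matrix (Fin n) (Fin n) ℝ) - (J q)ᵀ * J q).PosSemidef)
    (ξ : ℝ) (hξ : 0 < ξ)
    (hcons : ∀ t, 0 ≤ t → ∀ l,
      (fMat (Θ t l) - ξ • (1 : Matrix (Fin 3 ⊕ Fin 1) (Fin 3 ⊕ Fin 1) ℝ)).PosDef)
    (ζ : ℝ) (hζ : 0 ≤ ζ)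
    (hub : ∀ t, 0 ≤ t → ∀ l,
      (ζ • (1 : Matrix (Fin 3 ⊕ Fin 1) (Fin 3 ⊕ Fin 1) ℝ) - fMat (Θ t l)).PosDef) :
    ∃ α₁ α₂ : ℝ, 0 < α₁ ∧ α₁ ≤ α₂ ∧
      ∀ (q : Fin n → ℝ) (t : ℝ), 0 ≤ t →
        (massMatrix J (Θ t) q - α₁ • (1 : Matrix (Fin n) (Fin n) ℝ)).PosSemidef ∧
          (α₂ • (1 : Matrix (Fin n) (Fin n) ℝ) - massMatrix J (Θ t) q).PosSemidef := by
  refine ⟨ξ * γ, 2 * ζ * δ + ξ * γ, by positivity, le_add_of_nonneg_left (by positivity),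
    fun q t ht => ⟨?_, ?_⟩⟩
  · have hZ : (calZ (Θ t) - ξ • 1).PosSemidef := by
      rw [calZ_sub_smul_one]
      exact .blockDiagonal fun l => ZMat_sub_smul_one_posSemidef hξ.le (hcons t ht l).posSemidef
    have key : massMatrix J (Θ t) q - (ξ * γ) • 1 =
        (J q)ᵀ * (calZ (Θ t) - ξ • 1) * J q + ξ • ((J q)ᵀ * J q - γ • 1) := by
      simp only [massMatrix, Matrix.mul_sub, Matrix.sub_mul, Matrix.mul_smul, Matrix.smul_mul,
        Matrix.mul_one]
      module
    rw [key]
    exact (hZ.transpose_mul_mul_same _).add ((hJl q).smul hξ.le)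
  · have hZ : ((2 * ζ) • 1 - calZ (Θ t)).PosSemidef := by
      rw [smul_one_sub_calZ]
      exact .blockDiagonal fun l => smul_one_sub_ZMat_posSemidef hζ (hub t ht l).posSemidef
    have key : (2 * ζ * δ + ξ * γ) • 1 - massMatrix J (Θ t) q =
        (J q)ᵀ * ((2 * ζ) • 1 - calZ (Θ t)) * J q + (2 * ζ) • (δ • 1 - (J q)ᵀ * J q) +
          (ξ * γ) • 1 := by
      simp only [massMatrix, Matrix.mul_sub, Matrix.sub_mul, Matrix.mul_smul, Matrix.smul_mul,
        Matrix.mul_one]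
      module
    rw [key]
    exact ((hZ.transpose_mul_mul_same _).add ((hJu q).smul (by positivity))).add
      (Matrix.PosSemidef.one.smul (by positivity))

end
end
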